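/- There are no positive integers n and a such that α^n = √5 · 2^a, where α = (1+√5)/2 is the golden ratio. -/

import Mathlib

/-- A rational multiple of the golden ratio is rational only when the multiple is zero. -/
theorem eq_zero_of_goldenRatio_mul_eq_ratCast {p q : ℚ} (h : Real.goldenRatio * p = q) :
    p = 0 := by
  by_contra hp
  exact (Real.goldenRatio_irrational.mul_ratCast hp).ne_rat q h

theorem no_golden_power_eq_sqrt_five_mul_pow_two :
    ¬ ∃ n a : ℕ, 0 < n ∧ 0 < a ∧
      ((1 + Real.sqrt 5) / 2) ^ n = Real.sqrt 5 * 2 ^ a := by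
  rintro ⟨n, a, hn, -, h⟩
  obtain ⟨m, rfl⟩ := Nat.exists_eq_add_of_lt hn
  rw [zero_add] at h
  have hfib := Real.goldenRatio_mul_fib_succ_add_fib m
  have hsqrt : √5 = 2 * Real.goldenRatio - 1 := by
    rw [Real.goldenRatio]
    ring
  change Real.goldenRatio ^ (m + 1) = _ at h
  rw [← hfib, hsqrt] at h
  have hrat : Real.goldenRatio * ((Nat.fib (m + 1) - 2 * 2 ^ a : ℚ) : ℝ) =
      ((-(2 ^ a + Nat.fib m) : ℚ) : ℝ) := by
    push_cast
    linear_combination h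
  have hzero := eq_zero_of_goldenRatio_mul_eq_ratCast hrat
  rw [hzero, Rat.cast_zero, mul_zero, eq_comm, Rat.cast_eq_zero] at hrat
  have : (0 : ℚ) < 2 ^ a + Nat.fib m := by positivity
  linarith
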